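/- Let ℓ ≥ 1 and ℓ+3 ≤ N ≤ 2ℓ+2, and consider the M_ℓ model on the open chain of N sites with special boundary conditions s = (c₁, c_N), 0 ≤ c₁, c_N ≤ ℓ. Then: (i) if c₁ ≥ N−ℓ−3, c_N ≥ N−ℓ−3 and c₁ + c_N < N−2, dim H_Q^f = 1 for f = N−3 and 0 for every other f; (ii) if ℓ+3 < N ≤ 2ℓ+2, c₁ < N−ℓ−3, c_N < N−ℓ−3 and c₁ + c_N ≥ N−ℓ−4, dim H_Q^f = 1 for f = N−4 and 0 for every other f; in all other cases H_Q^f = 0 for every f. -/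

import Mathlib

attribute [local instance 10] Classical.propDecidable

noncomputable section

/-- A configuration of `N` sites: `true` = occupied, `false` = empty. -/
abbrev Config (N : ℕ) := Fin N → Bool

/-- Extension of a configuration to all of `ℕ`, by empty sites outside the chain. -/
def extc {N : ℕ} (σ : Config N) (t : ℕ) : Bool :=
  if h : t < N then σ ⟨t, h⟩ else false

/-- The fermion number: the number of occupied sites. -/
def fermions {N : ℕ} (σ : Config N) : ℕ :=
  (Finset.univ.filter fun i => σ i = true).card

/-- Allowed configurations of the open chain of `N` sites with exclusion parameter `ℓ`
and special boundary conditions `(c₁, cN)`: no cluster is longer than `ℓ`, the cluster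
containing the first site (if occupied) has length at most `c₁`, and the cluster
containing the last site (if occupied) has length at most `cN`. -/
def OpenOK (N ℓ c₁ cN : ℕ) (σ : Config N) : Prop :=
  (∀ a : ℕ, ¬ ∀ k ≤ ℓ, extc σ (a + k) = true) ∧
  (¬ (c₁ + 1 ≤ N ∧ ∀ k ≤ c₁, extc σ k = true)) ∧
  (¬ (cN + 1 ≤ N ∧ ∀ k ≤ cN, extc σ (N - 1 - k) = true))

/-- Cyclic shift of a site of the closed chain by `k` steps. -/
def cyc {N : ℕ} (i : Fin N) (k : ℕ) : Fin N :=
  ⟨(i.1 + k) % N, Nat.mod_lt _ i.pos⟩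

/-- Allowed configurations of the closed chain of `N` sites with periodic boundary
conditions: the chain is not fully occupied and no maximal cyclic run of occupied
sites is longer than `ℓ`. -/
def PerOK (N ℓ : ℕ) (σ : Config N) : Prop :=
  ∀ i : Fin N, ∃ k ≤ ℓ, σ (cyc i k) = false

/-- The fermionic sign `(-1)^{#{j < i : σ j = 1}}`. -/
def sgn {N : ℕ} (σ : Config N) (i : Fin N) : ℂ :=
  (-1 : ℂ) ^ ((Finset.univ.filter fun j => j < i ∧ σ j = true).card)

/-- The Hilbert space `V_N`: complex functions on allowed configurations. -/
abbrev AState (N : ℕ) (OK : Config N → Prop) := {σ : Config N // OK σ} → ℂ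

/-- Matrix of the supercharge with amplitudes `A`, with particle insertion
restricted to the sublattice `S`: the entry `(τ, σ)` is the amplitude (with fermionic
sign) for obtaining `τ` from `σ` by occupying an empty site of `S`. -/
def QmatA (N : ℕ) (OK : Config N → Prop) (S : Fin N → Prop)
    (A : Config N → Fin N → ℂ) :
    Matrix {σ : Config N // OK σ} {σ : Config N // OK σ} ℂ := fun τ σ =>
  ∑ i : Fin N,
    if S i ∧ σ.1 i = false ∧ τ.1 = Function.update σ.1 i true
    then A σ.1 i * sgn σ.1 i else 0

/-- The supercharge with amplitudes `A` restricted to the sublattice `S`, as a linear map. -/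
def QopA (N : ℕ) (OK : Config N → Prop) (S : Fin N → Prop)
    (A : Config N → Fin N → ℂ) : AState N OK →ₗ[ℂ] AState N OK :=
  (QmatA N OK S A).mulVecLin

/-- The unit-coupling supercharge restricted to the sublattice `S`. -/
def Qop (N : ℕ) (OK : Config N → Prop) (S : Fin N → Prop) :
    AState N OK →ₗ[ℂ] AState N OK :=
  QopA N OK S fun _ _ => 1

/-- The subspace `V_{N,f}` of states supported on configurations with fermion number `f`. -/
def gradeV (N : ℕ) (OK : Config N → Prop) (f : ℕ) :
    Submodule ℂ (AState N OK) where
  carrier := {ψ | ∀ σ, fermions σ.1 ≠ f → ψ σ = 0}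
  add_mem' := by
    intro a b ha hb σ h
    show a σ + b σ = 0
    rw [ha σ h, hb σ h, add_zero]
  zero_mem' := by intro σ h; rfl
  smul_mem' := by
    intro c a ha σ h
    show c * a σ = 0
    rw [ha σ h, mul_zero]

/-- The cocycles at gradeV `f`: `ker Q ∩ V_{N,f}` (for the supercharge restricted to `S`). -/
def cocycles (N : ℕ) (OK : Config N → Prop) (S : Fin N → Prop) (f : ℕ) :
    Submodule ℂ (AState N OK) :=
  LinearMap.ker (Qop N OK S) ⊓ gradeV N OK f

/-- The coboundaries at gradeV `f`: `Q (V_{N,f-1})` (for the supercharge restricted to `S`). -/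
def cobounds (N : ℕ) (OK : Config N → Prop) (S : Fin N → Prop) (f : ℕ) :
    Submodule ℂ (AState N OK) :=
  (gradeV N OK (f - 1)).map (Qop N OK S)

/-- The cohomology `H_Q^f = ker (Q : V_{N,f} → V_{N,f+1}) / Q (V_{N,f-1})`. -/
abbrev CohSpace (N : ℕ) (OK : Config N → Prop) (S : Fin N → Prop) (f : ℕ) :=
  cocycles N OK S f ⧸ ((cobounds N OK S f).comap (cocycles N OK S f).subtype)

/-- The dimension of `H_Q^f`. -/
def cohDim (N : ℕ) (OK : Config N → Prop) (S : Fin N → Prop) (f : ℕ) : ℕ :=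
  Module.finrank ℂ (CohSpace N OK S f)

/-- The cohomology class represented by a cocycle. -/
def cohClass (N : ℕ) (OK : Config N → Prop) (S : Fin N → Prop) (f : ℕ)
    (ψ : AState N OK) (h : ψ ∈ cocycles N OK S f) : CohSpace N OK S f :=
  Submodule.Quotient.mk ⟨ψ, h⟩

/-- Extension of a state by zero to all configurations. -/
def extendState {N : ℕ} {F : Config N → Prop} (ψ : AState N F) (σ : Config N) : ℂ :=
  if h : F σ then ψ ⟨σ, h⟩ else 0

/-- The supercharge on functions of all configurations. -/
def freeCharge {N : ℕ} (φ : Config N → ℂ) (τ : Config N) : ℂ :=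
  ∑ i, if τ i = true then sgn τ i * φ (Function.update τ i false) else 0

theorem sgn_update_self {N : ℕ} (σ : Config N) (i : Fin N) (b : Bool) :
    sgn (Function.update σ i b) i = sgn σ i := by
  unfold sgn
  congr 2
  ext j
  by_cases h : j = i <;> simp [h]

theorem sgn_update_of_lt {N : ℕ} (σ : Config N) {i j : Fin N} (h : i < j) (b : Bool) :
    sgn (Function.update σ j b) i = sgn σ i := by
  unfold sgn
  congr 2
  ext k
  by_cases hk : k = j
  · subst hk; simp [h.le]
  · simp [hk]

theorem sgn_update_false_of_gt {N : ℕ} (σ : Config N) {i j : Fin N} (h : i < j)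
    (hi : σ i = true) : sgn (Function.update σ i false) j = -sgn σ j := by
  unfold sgn
  have : (Finset.univ.filter fun k => k < j ∧ σ k = true) =
      insert i (Finset.univ.filter fun k => k < j ∧ Function.update σ i false k = true) := by
    ext k
    by_cases hk : k = i
    · subst hk; simp [h, hi]
    · simp [hk]
  rw [this, Finset.card_insert_of_notMem (by simp), pow_succ]
  ring

theorem sgn_mul_self {N : ℕ} (σ : Config N) (i : Fin N) : sgn σ i * sgn σ i = 1 := by
  unfold sgn
  rw [← mul_pow]
  simp

theorem freeCharge_freeCharge {N : ℕ} (φ : Config N → ℂ) (τ : Config N) :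
    freeCharge (freeCharge φ) τ = 0 := by
  set g : Fin N → Fin N → ℂ := fun i j =>
    if τ i = true ∧ Function.update τ i false j = true then
      sgn τ i * sgn (Function.update τ i false) j *
        φ (Function.update (Function.update τ i false) j false) else 0 with hg
  have hS : freeCharge (freeCharge φ) τ = ∑ i, ∑ j, g i j := by
    unfold freeCharge
    refine Finset.sum_congr rfl fun i _ => ?_
    by_cases hi : τ i = true
    · simp only [hi, hg, if_true, true_and, Finset.mul_sum]
      refine Finset.sum_congr rfl fun j _ => ?_
      split_ifs <;> ring
    · simp [hi, hg]
  have key : ∀ i j, i < j → g i j = -g j i := by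
    intro i j hij
    simp only [hg]
    by_cases hi : τ i = true <;> by_cases hj : τ j = true <;> simp [hi, hj, hij.ne, hij.ne']
    rw [sgn_update_false_of_gt τ hij hi, sgn_update_of_lt τ hij,
      Function.update_comm hij.ne]
    ring
  have anti : ∀ i j, g i j = -g j i := by
    intro i j
    rcases lt_trichotomy i j with h | h | h
    · exact key i j h
    · subst h; simp [hg]
    · rw [key j i h, neg_neg]
  have hneg : ∑ i, ∑ j, g i j = -∑ i, ∑ j, g i j := by
    conv_lhs => rw [Finset.sum_comm]
    rw [← Finset.sum_neg_distrib]
    refine Finset.sum_congr rfl fun i _ => ?_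
    rw [← Finset.sum_neg_distrib]
    exact Finset.sum_congr rfl fun j _ => anti j i
  rw [hS]
  linear_combination (1 / 2 : ℂ) * hneg

theorem Qop_apply {N : ℕ} {F : Config N → Prop} (ψ : AState N F) (τ : {σ // F σ}) :
    Qop N F (fun _ => True) ψ τ = freeCharge (extendState ψ) τ.1 := by
  unfold Qop QopA freeCharge
  rw [Matrix.mulVecLin_apply]
  unfold Matrix.mulVec dotProduct QmatA
  simp only [Finset.sum_mul]
  rw [Finset.sum_comm]
  refine Finset.sum_congr rfl fun i _ => ?_
  have hiff : ∀ σ : {σ // F σ}, (True ∧ σ.1 i = false ∧ τ.1 = Function.update σ.1 i true) ↔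
      τ.1 i = true ∧ σ.1 = Function.update τ.1 i false := by
    intro σ
    constructor
    · rintro ⟨-, h1, h2⟩
      rw [h2]
      simp [← h1]
    · rintro ⟨h1, h2⟩
      rw [h2]
      simp [← h1]
  simp only [hiff]
  by_cases hi : τ.1 i = true
  · simp only [hi, true_and, if_true]
    by_cases hF : F (Function.update τ.1 i false)
    · rw [Finset.sum_eq_single ⟨_, hF⟩]
      · simp [extendState, hF, sgn_update_self]
      · intro σ _ hσ
        rw [if_neg fun h => hσ (Subtype.ext h), zero_mul]
      · simp
    · rw [Finset.sum_eq_zero]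
      · simp [extendState, hF]
      · intro σ _
        rw [if_neg fun h : σ.1 = Function.update τ.1 i false => hF (h ▸ σ.2), zero_mul]
  · simp [hi]

theorem extendState_coe {N : ℕ} {F : Config N → Prop} (ψ : AState N F) (σ : {σ // F σ}) :
    extendState ψ σ.1 = ψ σ := by
  simp [extendState, σ.2]

theorem extendState_of_not {N : ℕ} {F : Config N → Prop} (ψ : AState N F) {σ : Config N}
    (h : ¬F σ) : extendState ψ σ = 0 := by
  simp [extendState, h]

theorem update_false_le {N : ℕ} (τ : Config N) (i : Fin N) : Function.update τ i false ≤ τ :=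
  update_le_self_iff.2 (Bool.false_le _)

theorem le_update_true {N : ℕ} (τ : Config N) (i : Fin N) : τ ≤ Function.update τ i true :=
  le_update_self_iff.2 (Bool.le_true _)

theorem Qop_Qop {N : ℕ} {F : Config N → Prop} (hF : Set.OrdConnected {σ | F σ})
    (ψ : AState N F) : Qop N F (fun _ => True) (Qop N F (fun _ => True) ψ) = 0 := by
  funext τ
  rw [Qop_apply, Pi.zero_apply, ← freeCharge_freeCharge (extendState ψ) τ.1]
  refine Finset.sum_congr rfl fun i _ => ?_
  split_ifs with hi
  · congr 1
    by_cases h : F (Function.update τ.1 i false)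
    · exact (extendState_coe _ ⟨_, h⟩).trans (Qop_apply ψ ⟨_, h⟩)
    · rw [extendState_of_not _ h]
      refine (Finset.sum_eq_zero fun j _ => ?_).symm
      split_ifs with hj
      · rw [extendState_of_not, mul_zero]
        intro h'
        exact h (hF.out h' τ.2 ⟨update_false_le _ _, update_false_le _ _⟩)
      · rfl
  · rfl

/-- Extension by zero of states on a smaller family of configurations to a larger one. -/
def inclState {N : ℕ} (F' F : Config N → Prop) : AState N F' →ₗ[ℂ] AState N F where
  toFun ψ σ := extendState ψ σ.1
  map_add' a b := by
    funext σ
    by_cases h : F' σ.1 <;> simp [extendState, h]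
  map_smul' c a := by
    funext σ
    by_cases h : F' σ.1 <;> simp [extendState, h]

theorem extendState_inclState {N : ℕ} {F' F : Config N → Prop} (hsub : ∀ σ, F' σ → F σ)
    (ψ : AState N F') : extendState (inclState F' F ψ) = extendState ψ := by
  funext σ
  by_cases h : F σ
  · exact extendState_coe (inclState F' F ψ) ⟨σ, h⟩
  · rw [extendState_of_not _ h, extendState_of_not _ fun h' => h (hsub σ h')]

theorem inclState_injective {N : ℕ} {F' F : Config N → Prop} (hsub : ∀ σ, F' σ → F σ) :
    Function.Injective (inclState F' F) := by
  intro a b hab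
  funext σ
  have := congrFun hab ⟨σ.1, hsub _ σ.2⟩
  simpa [inclState, extendState, σ.2] using this

theorem Qop_inclState {N : ℕ} {F' F : Config N → Prop} (hsub : ∀ σ, F' σ → F σ)
    (hup : ∀ σ τ, σ ≤ τ → F' σ → F τ → F' τ) (ψ : AState N F') :
    Qop N F (fun _ => True) (inclState F' F ψ) =
      inclState F' F (Qop N F' (fun _ => True) ψ) := by
  funext τ
  rw [Qop_apply, extendState_inclState hsub]
  by_cases h : F' τ.1
  · exact ((extendState_coe _ ⟨τ.1, h⟩).trans (Qop_apply ψ ⟨τ.1, h⟩)).symm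
  · refine Eq.trans (Finset.sum_eq_zero fun i _ => ?_) (extendState_of_not _ h).symm
    split_ifs with hi
    · rw [extendState_of_not, mul_zero]
      exact fun h' => h (hup _ _ (update_false_le _ _) h' τ.2)
    · rfl

theorem fermions_update_true {N : ℕ} (σ : Config N) (v : Fin N) (hv : σ v = false) :
    fermions (Function.update σ v true) = fermions σ + 1 := by
  unfold fermions
  rw [← Finset.card_insert_of_notMem (a := v) (by simp [hv])]
  congr 1
  ext k
  by_cases hk : k = v <;> simp [hk]

/-- The homotopy that removes a particle from the site `v`. -/
def removeAt {N : ℕ} {F : Config N → Prop} (v : Fin N) (ψ : AState N F) : AState N F :=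
  fun σ => if σ.1 v = false then sgn σ.1 v * extendState ψ (Function.update σ.1 v true) else 0

theorem removeAt_mem_gradeV {N : ℕ} {F : Config N → Prop} (v : Fin N) {ψ : AState N F} {f : ℕ}
    (hψ : ψ ∈ gradeV N F f) : removeAt v ψ ∈ gradeV N F (f - 1) := by
  intro σ hσ
  unfold removeAt
  split_ifs with hv
  · by_cases h : F (Function.update σ.1 v true)
    · have : extendState ψ (Function.update σ.1 v true) = 0 := by
        rw [extendState, dif_pos h]
        refine hψ _ fun h' => hσ ?_
        rw [← h', fermions_update_true _ _ hv, Nat.add_sub_cancel]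
      rw [this, mul_zero]
    · rw [extendState_of_not _ h, mul_zero]
  · rfl

theorem freeCharge_eq_single {N : ℕ} (φ : Config N → ℂ) {τ : Config N} {v : Fin N}
    (hv : τ v = true) (hφ : ∀ σ, σ v = true → φ σ = 0) :
    freeCharge φ τ = sgn τ v * φ (Function.update τ v false) := by
  unfold freeCharge
  rw [Finset.sum_eq_single v, if_pos hv]
  · intro i _ hi
    rw [hφ _ (by rw [Function.update_of_ne hi.symm, hv]), mul_zero, ite_self]
  · simp

theorem Qop_removeAt {N : ℕ} {F : Config N → Prop} {v : Fin N}
    (hdown : ∀ σ, F σ → F (Function.update σ v false)) (ψ : AState N F)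
    (τ : {σ // F σ}) (hv : τ.1 v = true) :
    Qop N F (fun _ => True) (removeAt v ψ) τ = ψ τ := by
  rw [Qop_apply, freeCharge_eq_single _ hv]
  · have h := hdown _ τ.2
    have e : Function.update (Function.update τ.1 v false) v true = τ.1 := by
      simp [← hv]
    rw [extendState, dif_pos h]
    simp only [removeAt, Function.update_self, if_true, e]
    rw [sgn_update_self, ← mul_assoc, sgn_mul_self, one_mul, extendState_coe]
  · intro σ hσ
    by_cases h : F σ
    · simp [extendState, h, removeAt, hσ]
    · exact extendState_of_not _ h

/-- The configurations of `F` in which `v` is empty and cannot be filled. -/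
def critical {N : ℕ} (F : Config N → Prop) (v : Fin N) (σ : Config N) : Prop :=
  F σ ∧ σ v = false ∧ ¬F (Function.update σ v true)

theorem critical_up {N : ℕ} {F : Config N → Prop} (hF : Set.OrdConnected {σ | F σ})
    (v : Fin N) (σ τ : Config N) (h : σ ≤ τ) (hσ : critical F v σ) (hτ : F τ) :
    critical F v τ := by
  have hup : Function.update σ v true ≤ Function.update τ v true :=
    update_le_update_iff.2 ⟨le_rfl, fun j _ => h j⟩
  have hv : τ v = false := by
    by_contra hv
    rw [Bool.not_eq_false] at hv
    refine hσ.2.2 (hF.out hσ.1 hτ ⟨le_update_true _ _, ?_⟩)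
    have e : Function.update τ v true = τ := by simp [← hv]
    exact e ▸ hup
  exact ⟨hτ, hv, fun h' => hσ.2.2 (hF.out hσ.1 h' ⟨le_update_true _ _, hup⟩)⟩

theorem exists_inclState_eq {N : ℕ} {F : Config N → Prop} {v : Fin N}
    {ψ : AState N F} (hψ : ∀ τ, τ.1 v = true → ψ τ = 0)
    (hQ : ∀ τ, τ.1 v = true → Qop N F (fun _ => True) ψ τ = 0) :
    inclState (critical F v) F (fun σ => ψ ⟨σ.1, σ.2.1⟩) = ψ := by
  funext σ
  by_cases h : critical F v σ.1
  · simp [inclState, extendState, h]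
  · rw [show inclState (critical F v) F _ σ = 0 from extendState_of_not _ h]
    symm
    by_cases hv : σ.1 v = true
    · exact hψ _ hv
    · rw [Bool.not_eq_true] at hv
      have hF : F (Function.update σ.1 v true) := by
        by_contra h'
        exact h ⟨σ.2, hv, h'⟩
      have h0 := hQ ⟨_, hF⟩ (by simp)
      rw [Qop_apply, freeCharge_eq_single (v := v) _ (by simp)] at h0
      · have e : Function.update (Function.update σ.1 v true) v false = σ.1 := by
          simp [← hv]
        simp only [e, extendState_coe] at h0
        have := sgn_mul_self (Function.update σ.1 v true) v
        rcases mul_eq_zero.1 h0 with h1 | h1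
        · simp [h1] at this
        · exact h1
      · intro ρ hρ
        by_cases h' : F ρ
        · rw [extendState, dif_pos h', hψ _ hρ]
        · exact extendState_of_not _ h'

theorem Qop_mem_gradeV {N : ℕ} {F : Config N → Prop} {f : ℕ} {ψ : AState N F}
    (hψ : ψ ∈ gradeV N F f) : Qop N F (fun _ => True) ψ ∈ gradeV N F (f + 1) := by
  intro τ hτ
  rw [Qop_apply]
  refine Finset.sum_eq_zero fun i _ => ?_
  split_ifs with hi
  · by_cases h : F (Function.update τ.1 i false)
    · rw [extendState, dif_pos h, hψ, mul_zero]
      intro h'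
      refine hτ ?_
      rw [← h', ← fermions_update_true _ i (by simp)]
      simp [← hi]
    · rw [extendState_of_not _ h, mul_zero]
  · rfl

theorem inclState_mem_gradeV_iff {N : ℕ} {F' F : Config N → Prop} (hsub : ∀ σ, F' σ → F σ)
    {f : ℕ} {ψ : AState N F'} : inclState F' F ψ ∈ gradeV N F f ↔ ψ ∈ gradeV N F' f := by
  constructor
  · intro h σ hσ
    have := h ⟨σ.1, hsub _ σ.2⟩ hσ
    simpa [inclState, extendState, σ.2] using this
  · intro h σ hσ
    by_cases h' : F' σ.1
    · simpa [inclState, extendState, h'] using h ⟨σ.1, h'⟩ hσ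
    · exact extendState_of_not _ h'

/-- Subtracting a coboundary makes a state vanish wherever `v` is occupied; the state then
lives on the critical configurations as soon as its charge vanishes where `v` is occupied. -/
theorem exists_reduction {N : ℕ} {F : Config N → Prop} (hF : Set.OrdConnected {σ | F σ})
    {v : Fin N} (hdown : ∀ σ, F σ → F (Function.update σ v false)) {f : ℕ} {ψ : AState N F}
    (hψ : ψ ∈ gradeV N F f)
    (hQ : ∀ τ, τ.1 v = true → Qop N F (fun _ => True) ψ τ = 0) :
    ∃ ψ' ∈ gradeV N (critical F v) f, ∃ χ ∈ gradeV N F (f - 1),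
      inclState (critical F v) F ψ' = ψ - Qop N F (fun _ => True) χ := by
  set χ := removeAt v ψ with hχ
  have hmem : χ ∈ gradeV N F (f - 1) := removeAt_mem_gradeV v hψ
  have hQχ : Qop N F (fun _ => True) χ ∈ gradeV N F f := by
    rcases f with _ | f
    · have : χ = 0 := by
        funext σ
        rw [hχ, removeAt, Pi.zero_apply]
        split_ifs with hv
        · by_cases h : F (Function.update σ.1 v true)
          · rw [extendState, dif_pos h, hψ, mul_zero]
            rw [fermions_update_true _ _ hv]
            omega
          · rw [extendState_of_not _ h, mul_zero]
        · rfl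
      rw [this, map_zero]
      exact Submodule.zero_mem _
    · exact Qop_mem_gradeV hmem
  have key := exists_inclState_eq (v := v) (ψ := ψ - Qop N F (fun _ => True) χ)
    (fun τ hτ => by rw [Pi.sub_apply, Qop_removeAt hdown ψ τ hτ, sub_self])
    (fun τ hτ => by rw [map_sub, Qop_Qop hF, sub_zero, hQ τ hτ])
  refine ⟨_, ?_, χ, hmem, key⟩
  rw [← inclState_mem_gradeV_iff (F := F) fun _ h => h.1, key]
  exact Submodule.sub_mem _ hψ hQχ

/-- If the site `v` can always be emptied in the convex family `F`, then the cohomology of `F`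
is that of its critical configurations. -/
theorem cohDim_critical {N : ℕ} {F : Config N → Prop} (hF : Set.OrdConnected {σ | F σ})
    (v : Fin N) (hdown : ∀ σ, F σ → F (Function.update σ v false)) (f : ℕ) :
    cohDim N F (fun _ => True) f = cohDim N (critical F v) (fun _ => True) f := by
  have hsub : ∀ σ, critical F v σ → F σ := fun _ h => h.1
  have hcomm := Qop_inclState hsub (critical_up hF v)
  have hmaps : ∀ ψ ∈ cocycles N (critical F v) (fun _ => True) f,
      inclState (critical F v) F ψ ∈ cocycles N F (fun _ => True) f := by
    rintro ψ ⟨h1, h2⟩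
    refine ⟨?_, (inclState_mem_gradeV_iff hsub).2 h2⟩
    rw [SetLike.mem_coe, LinearMap.mem_ker] at h1 ⊢
    rw [hcomm, h1, map_zero]
  set φ := ((cobounds N F (fun _ => True) f).comap
    (cocycles N F (fun _ => True) f).subtype).mkQ ∘ₗ
      (inclState (critical F v) F).restrict hmaps with hφ
  have hsurj : Function.Surjective φ := by
    intro y
    obtain ⟨⟨ψ, hψ1, hψ2⟩, rfl⟩ := Submodule.mkQ_surjective _ y
    rw [SetLike.mem_coe, LinearMap.mem_ker] at hψ1
    obtain ⟨ψ', hψ', χ, hχ, he⟩ := exists_reduction hF hdown hψ2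
      (fun τ _ => by rw [hψ1]; rfl)
    have hker : Qop N (critical F v) (fun _ => True) ψ' = 0 := by
      apply inclState_injective hsub
      rw [← hcomm, he, map_sub, hψ1, Qop_Qop hF, sub_zero, map_zero]
    refine ⟨⟨ψ', hker, hψ'⟩, ?_⟩
    rw [hφ, LinearMap.comp_apply, Submodule.mkQ_apply, Submodule.mkQ_apply,
      Submodule.Quotient.eq]
    refine ⟨-χ, Submodule.neg_mem _ hχ, ?_⟩
    simp only [map_neg, Submodule.subtype_apply, AddSubgroupClass.coe_sub,
      LinearMap.coe_restrict_apply]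
    rw [he]
    abel
  have hkerφ : LinearMap.ker φ = (cobounds N (critical F v) (fun _ => True) f).comap
      (cocycles N (critical F v) (fun _ => True) f).subtype := by
    ext ⟨ψ, hψ⟩
    rw [LinearMap.mem_ker, hφ, LinearMap.comp_apply, Submodule.mkQ_apply,
      Submodule.Quotient.mk_eq_zero]
    constructor
    · rintro ⟨χ, hχ, he⟩
      simp only [Submodule.subtype_apply, LinearMap.coe_restrict_apply] at he
      obtain ⟨χ', hχ', ξ, -, he'⟩ := exists_reduction (v := v) hF hdown hχ (fun τ hτ => by
        rw [he]
        exact extendState_of_not _ fun h => by simp [h.2.1] at hτ)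
      refine ⟨χ', hχ', inclState_injective hsub ?_⟩
      rw [← hcomm, he', map_sub, Qop_Qop hF, sub_zero, he]
      rfl
    · rintro ⟨χ, hχ, he⟩
      refine ⟨inclState _ F χ, (inclState_mem_gradeV_iff hsub).2 hχ, ?_⟩
      rw [hcomm, he]
      rfl
  unfold cohDim CohSpace
  rw [← hkerφ]
  exact (φ.quotKerEquivOfSurjective hsurj).finrank_eq.symm

theorem cohDim_eq_zero {N : ℕ} {F : Config N → Prop} (hF : ∀ σ, ¬F σ) (f : ℕ) :
    cohDim N F (fun _ => True) f = 0 := by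
  have : IsEmpty {σ // F σ} := ⟨fun σ => hF _ σ.2⟩
  exact Module.finrank_zero_of_subsingleton

theorem cohDim_singleton {N : ℕ} {F : Config N → Prop} (σ₀ : Config N)
    (hF : ∀ σ, F σ ↔ σ = σ₀) (f : ℕ) :
    cohDim N F (fun _ => True) f = if f = fermions σ₀ then 1 else 0 := by
  obtain rfl : F = fun σ => σ = σ₀ := funext fun σ => propext (hF σ)
  have hQ : Qop N (fun σ => σ = σ₀) (fun _ => True) = 0 := by
    refine LinearMap.ext fun ψ => ?_
    funext ⟨τ, hτ⟩
    rw [Qop_apply]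
    refine Finset.sum_eq_zero fun i _ => ?_
    split_ifs with hi
    · rw [extendState_of_not, mul_zero]
      intro h
      have := congrFun h i
      rw [Function.update_self, ← hτ] at this
      exact absurd hi (by simp [this])
    · rfl
  have hB : (cobounds N (fun σ => σ = σ₀) (fun _ => True) f).comap
      (cocycles N (fun σ => σ = σ₀) (fun _ => True) f).subtype = ⊥ := by
    rw [cobounds, hQ, Submodule.map_zero, Submodule.comap_bot, Submodule.ker_subtype]
  unfold cohDim CohSpace
  rw [hB, (Submodule.quotEquivOfEqBot _ rfl).finrank_eq]
  unfold cocycles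
  rw [hQ, LinearMap.ker_zero, top_inf_eq]
  split_ifs with h
  · have : gradeV N (fun σ => σ = σ₀) f = ⊤ := by
      rw [eq_top_iff]
      rintro ψ - ⟨σ, hσ⟩ hne
      exact absurd (h.trans (congrArg fermions hσ.symm)).symm hne
    rw [this, finrank_top]
    simp
  · have : gradeV N (fun σ => σ = σ₀) f = ⊥ := by
      rw [eq_bot_iff]
      intro ψ hψ
      rw [Submodule.mem_bot]
      funext ⟨σ, hσ⟩
      exact hψ _ fun h' => h (h'.symm.trans (congrArg fermions hσ))
    rw [this, finrank_bot]

/-- The configurations that are empty on `Z`, occupied on `O`, and do not fill any of the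
intervals `[a, b]` with `W a b`. -/
def intervalFamily (N : ℕ) (Z O : ℕ → Prop) (W : ℕ → ℕ → Prop) (σ : Config N) : Prop :=
  (∀ t, Z t → extc σ t = false) ∧ (∀ t, O t → extc σ t = true) ∧
    ∀ a b, W a b → ¬∀ t, a ≤ t → t ≤ b → extc σ t = true

/-- The site `v` is the only possible hole of `σ` in some interval `[a, b]` with `W a b`. -/
def IsPivot {N : ℕ} (W : ℕ → ℕ → Prop) (σ : Config N) (v : ℕ) : Prop :=
  ∃ a b, W a b ∧ a ≤ v ∧ v ≤ b ∧ ∀ t, a ≤ t → t ≤ b → t ≠ v → extc σ t = true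

theorem extc_coe {N : ℕ} (σ : Config N) (i : Fin N) : extc σ i = σ i := by
  simp [extc]

theorem lt_of_extc {N : ℕ} {σ : Config N} {t : ℕ} (h : extc σ t = true) : t < N := by
  by_contra h'
  simp [extc, h'] at h

theorem extc_update_self {N : ℕ} (σ : Config N) (v : Fin N) (b : Bool) :
    extc (Function.update σ v b) v = b := by
  simp [extc_coe]

theorem extc_update_of_ne {N : ℕ} (σ : Config N) (v : Fin N) (b : Bool) {t : ℕ}
    (h : t ≠ v) : extc (Function.update σ v b) t = extc σ t := by
  unfold extc
  split_ifs with ht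
  · rw [Function.update_of_ne]
    exact fun h' => h (congrArg Fin.val h')
  · rfl

theorem extc_mono {N : ℕ} {σ τ : Config N} (h : σ ≤ τ) (t : ℕ) (ht : extc σ t = true) :
    extc τ t = true := by
  have hN := lt_of_extc ht
  simp only [extc, hN, dif_pos] at ht ⊢
  have hle := h ⟨t, hN⟩
  rw [ht] at hle
  exact top_le_iff.1 hle

theorem ordConnected_intervalFamily (N : ℕ) (Z O : ℕ → Prop) (W : ℕ → ℕ → Prop) :
    Set.OrdConnected {σ | intervalFamily N Z O W σ} := by
  refine ⟨fun σ hσ τ hτ ρ hρ => ⟨fun t ht => ?_, fun t ht => ?_, fun a b hab h => ?_⟩⟩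
  · have := hτ.1 t ht
    by_contra h
    rw [extc_mono hρ.2 t (by simpa using h)] at this
    exact absurd this (by simp)
  · exact extc_mono hρ.1 t (hσ.2.1 t ht)
  · exact hτ.2.2 a b hab fun t h1 h2 => extc_mono hρ.2 t (h t h1 h2)

theorem intervalFamily_update_false {N : ℕ} {Z O : ℕ → Prop} {W : ℕ → ℕ → Prop} {v : Fin N}
    (hO : ¬O v) {σ : Config N} (h : intervalFamily N Z O W σ) :
    intervalFamily N Z O W (Function.update σ v false) := by
  have hle := extc_mono (update_false_le σ v)
  refine ⟨fun t ht => ?_, fun t ht => ?_, fun a b hab h' => ?_⟩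
  · by_contra hc
    exact absurd (hle t (by simpa using hc)) (by simp [h.1 t ht])
  · rw [extc_update_of_ne _ _ _ (by rintro rfl; exact hO ht)]
    exact h.2.1 t ht
  · exact h.2.2 a b hab fun t h1 h2 => hle t (h' t h1 h2)

theorem critical_intervalFamily_iff {N : ℕ} {Z O : ℕ → Prop} {W : ℕ → ℕ → Prop} {v : Fin N}
    (hZ : ¬Z v) (σ : Config N) : critical (intervalFamily N Z O W) v σ ↔
      intervalFamily N (fun t => Z t ∨ t = v) O W σ ∧ IsPivot W σ v := by
  constructor
  · rintro ⟨h, hv, hn⟩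
    refine ⟨⟨?_, h.2⟩, ?_⟩
    · rintro t (ht | rfl)
      · exact h.1 t ht
      · rw [extc_coe, hv]
    · by_contra hp
      refine hn ⟨fun t ht => ?_, fun t ht => ?_, fun a b hab h' => ?_⟩
      · rw [extc_update_of_ne _ _ _ (by rintro rfl; exact hZ ht)]
        exact h.1 t ht
      · exact extc_mono (le_update_true σ v) t (h.2.1 t ht)
      · have hne : ∀ t, a ≤ t → t ≤ b → t ≠ v → extc σ t = true := fun t h1 h2 h3 => by
          rw [← extc_update_of_ne σ v true h3]
          exact h' t h1 h2
        by_cases hin : a ≤ v ∧ v ≤ b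
        · exact hp ⟨a, b, hab, hin.1, hin.2, hne⟩
        · exact h.2.2 a b hab fun t h1 h2 => hne t h1 h2 (by rintro rfl; exact hin ⟨h1, h2⟩)
  · rintro ⟨h, a, b, hab, -, -, hfull⟩
    refine ⟨⟨fun t ht => h.1 t (Or.inl ht), h.2⟩, ?_, fun h' => h'.2.2 a b hab ?_⟩
    · exact (extc_coe σ v).symm.trans (h.1 v (Or.inr rfl))
    · intro t h1 h2
      by_cases hne : t = v
      · rw [hne, extc_update_self]
      · rw [extc_update_of_ne _ _ _ hne]
        exact hfull t h1 h2 hne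

theorem cohDim_intervalFamily {N : ℕ} {Z O : ℕ → Prop} {W : ℕ → ℕ → Prop} {v : ℕ} (hv : v < N)
    (hZ : ¬Z v) (hO : ¬O v) {F : Config N → Prop}
    (hF : ∀ σ, F σ ↔ intervalFamily N (fun t => Z t ∨ t = v) O W σ ∧ IsPivot W σ v) (f : ℕ) :
    cohDim N (intervalFamily N Z O W) (fun _ => True) f = cohDim N F (fun _ => True) f := by
  rw [cohDim_critical (ordConnected_intervalFamily N Z O W) ⟨v, hv⟩
    (fun σ => intervalFamily_update_false hO)]
  congr 1
  funext σ
  rw [hF, critical_intervalFamily_iff (v := ⟨v, hv⟩) hZ]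

theorem cohDim_intervalFamily_eq_zero {N : ℕ} {Z O : ℕ → Prop} {W : ℕ → ℕ → Prop} {v : ℕ}
    (hv : v < N) (hZ : ¬Z v) (hO : ¬O v)
    (hF : ∀ σ, intervalFamily N (fun t => Z t ∨ t = v) O W σ → ¬IsPivot W σ v) (f : ℕ) :
    cohDim N (intervalFamily N Z O W) (fun _ => True) f = 0 := by
  rw [cohDim_intervalFamily (F := fun _ => False) hv hZ hO
    (fun σ => ⟨False.elim, fun h => hF σ h.1 h.2⟩)]
  exact cohDim_eq_zero (fun _ h => h) f

/-- The configuration whose empty sites are those of `S`. -/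
def holesAt (N : ℕ) (S : Finset ℕ) : Config N := fun i => decide (i.1 ∉ S)

theorem extc_holesAt (N : ℕ) (S : Finset ℕ) (t : ℕ) :
    extc (holesAt N S) t = true ↔ t < N ∧ t ∉ S := by
  by_cases h : t < N <;> simp [extc, h, holesAt]

theorem eq_holesAt {N : ℕ} {S : Finset ℕ} {σ : Config N}
    (h0 : ∀ t ∈ S, extc σ t = false) (h1 : ∀ t < N, t ∉ S → extc σ t = true) :
    σ = holesAt N S := by
  funext i
  by_cases h : i.1 ∈ S
  · have := h0 _ h
    rw [extc_coe] at this
    simp [holesAt, h, this]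
  · have := h1 _ i.2 h
    rw [extc_coe] at this
    simp [holesAt, h, this]

theorem fermions_holesAt {N : ℕ} {S : Finset ℕ} (hS : ∀ t ∈ S, t < N) :
    fermions (holesAt N S) = N - S.card := by
  unfold fermions
  have h : (Finset.univ.filter fun i => holesAt N S i = true).map Fin.valEmbedding =
      Finset.range N \ S := by
    ext t
    simp only [Finset.mem_map, Finset.mem_filter, Finset.mem_univ, true_and, holesAt,
      decide_eq_true_eq, Fin.valEmbedding_apply, Finset.mem_sdiff, Finset.mem_range]
    exact ⟨by rintro ⟨i, hi, rfl⟩; exact ⟨i.2, hi⟩, fun ⟨h1, h2⟩ => ⟨⟨t, h1⟩, h2, rfl⟩⟩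
  rw [← Finset.card_map Fin.valEmbedding, h,
    Finset.card_sdiff_of_subset fun t ht => Finset.mem_range.2 (hS t ht), Finset.card_range]

theorem cohDim_intervalFamily_eq_ite {N : ℕ} {Z O : ℕ → Prop} {W : ℕ → ℕ → Prop} {v : ℕ}
    (hv : v < N) (hZ : ¬Z v) (hO : ¬O v) {S : Finset ℕ} (hS : ∀ t ∈ S, t < N)
    (hF : ∀ σ, intervalFamily N (fun t => Z t ∨ t = v) O W σ ∧ IsPivot W σ v ↔
      σ = holesAt N S) (f : ℕ) :
    cohDim N (intervalFamily N Z O W) (fun _ => True) f = if f = N - S.card then 1 else 0 := by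
  rw [cohDim_intervalFamily (F := fun σ => σ = holesAt N S) hv hZ hO (fun σ => (hF σ).symm),
    cohDim_singleton (holesAt N S) (fun _ => Iff.rfl), fermions_holesAt hS]

theorem openOK_iff {ℓ n c₁ cN s : ℕ} (hc₁ : c₁ ≤ ℓ) (hcN : cN ≤ ℓ) (hs : s + cN = ℓ + 1 + n)
    (σ : Config (ℓ + 2 + n)) : OpenOK (ℓ + 2 + n) ℓ c₁ cN σ ↔
      intervalFamily (ℓ + 2 + n) (fun _ => False) (fun _ => False)
        (fun a b => (a = 0 ∧ b = c₁) ∨ (a = s ∧ b = ℓ + 1 + n) ∨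
          (1 ≤ a ∧ a ≤ n ∧ b = a + ℓ)) σ := by
  constructor
  · rintro ⟨hw, hp, hsuf⟩
    refine ⟨fun t => False.elim, fun t => False.elim, ?_⟩
    rintro a b (⟨rfl, rfl⟩ | ⟨rfl, rfl⟩ | ⟨-, -, rfl⟩) h
    · exact hp ⟨by omega, fun k hk => h k (by omega) hk⟩
    · exact hsuf ⟨by omega, fun k hk => h _ (by omega) (by omega)⟩
    · exact hw a fun k hk => h _ (by omega) (by omega)
  · rintro ⟨-, -, hW⟩
    have hp := hW 0 c₁ (Or.inl ⟨rfl, rfl⟩)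
    have hsuf := hW s _ (Or.inr (Or.inl ⟨rfl, rfl⟩))
    refine ⟨fun a h => ?_, fun h => hp fun t _ ht => h.2 t ht, fun h => hsuf fun t h1 h2 => ?_⟩
    · have hfull : ∀ t, a ≤ t → t ≤ a + ℓ → extc σ t = true := fun t h1 h2 => by
        simpa [Nat.add_sub_cancel' h1] using h (t - a) (by omega)
      have hlt := lt_of_extc (h ℓ le_rfl)
      rcases Nat.eq_zero_or_pos a with rfl | ha
      · exact hp fun t h1 h2 => hfull t h1 (by omega)
      · rcases Nat.lt_or_ge n a with ha' | ha'
        · exact hsuf fun t h1 h2 => hfull t (by omega) (by omega)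
        · exact hW a _ (Or.inr (Or.inr ⟨ha, ha', rfl⟩)) hfull
    · have := h.2 (ℓ + 1 + n - t) (by omega)
      rwa [show ℓ + 2 + n - 1 - (ℓ + 1 + n - t) = t by omega] at this

/-- Emptying the two end sites reduces the open chain to the configurations with empty end
sites whose neighbouring sites are occupied as far as the boundary conditions allow. -/
theorem cohDim_openOK {ℓ n c₁ cN s : ℕ} (hn : 1 ≤ n) (hc₁ : c₁ ≤ ℓ) (hcN : cN ≤ ℓ)
    (hs : s + cN = ℓ + 1 + n) (f : ℕ) :
    cohDim (ℓ + 2 + n) (OpenOK (ℓ + 2 + n) ℓ c₁ cN) (fun _ => True) f =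
      cohDim (ℓ + 2 + n) (intervalFamily (ℓ + 2 + n) (fun t => t = 0 ∨ t = ℓ + 1 + n)
        (fun t => (1 ≤ t ∧ t ≤ c₁) ∨ (s ≤ t ∧ t ≤ ℓ + n))
        (fun a b => 1 ≤ a ∧ a ≤ n ∧ b = a + ℓ)) (fun _ => True) f := by
  rw [show OpenOK (ℓ + 2 + n) ℓ c₁ cN = _ from
    funext fun σ => propext (openOK_iff hc₁ hcN hs σ)]
  rw [cohDim_intervalFamily (v := 0) (by omega) (fun h => h) (fun h => h)
    (F := intervalFamily (ℓ + 2 + n) (fun t => t = 0) (fun t => 1 ≤ t ∧ t ≤ c₁)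
      (fun a b => (a = s ∧ b = ℓ + 1 + n) ∨ (1 ≤ a ∧ a ≤ n ∧ b = a + ℓ)))]
  · refine cohDim_intervalFamily (v := ℓ + 1 + n) (by omega) (by omega) (by omega) ?_ f
    intro σ
    constructor
    · rintro ⟨hZ, hO, hW⟩
      refine ⟨⟨hZ, fun t ht => hO t (Or.inl ht), ?_⟩, s, _, Or.inl ⟨rfl, rfl⟩, by omega,
        le_rfl, fun t h1 h2 h3 => hO t (by omega)⟩
      rintro a b (⟨rfl, rfl⟩ | hab) h
      · exact absurd (h (ℓ + 1 + n) (by omega) le_rfl) (by simp [hZ])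
      · exact hW a b hab h
    · rintro ⟨⟨hZ, hO, hW⟩, a, b, hab, ha, hb, hf⟩
      refine ⟨hZ, fun t ht => ?_, fun a b hab => hW a b (Or.inr hab)⟩
      rcases ht with ht | ht
      · exact hO t ht
      · exact hf t (by omega) (by omega) (by omega)
  · intro σ
    constructor
    · rintro ⟨hZ, hO, hW⟩
      refine ⟨⟨fun t ht => hZ t (by simpa using ht), fun t => False.elim, ?_⟩, 0, c₁,
        Or.inl ⟨rfl, rfl⟩, le_rfl, by omega, fun t h1 h2 h3 => hO t (by omega)⟩
      rintro a b (⟨rfl, rfl⟩ | hab) h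
      · exact absurd (h 0 le_rfl (by omega)) (by simp [hZ])
      · exact hW a b hab h
    · rintro ⟨⟨hZ, hO, hW⟩, a, b, hab, ha, hb, hf⟩
      exact ⟨fun t ht => hZ t (Or.inr ht), fun t ht => hf t (by omega) (by omega) (by omega),
        fun a b hab => hW a b (Or.inr hab)⟩

section Windows

variable {ℓ n c₁ s : ℕ}

/-- The prefix and the suffix together fill a window. -/
theorem cohDim_windows_of_overlap (hn : 1 ≤ n) (h : s ≤ c₁ + 1) (f : ℕ) :
    cohDim (ℓ + 2 + n) (intervalFamily (ℓ + 2 + n) (fun t => t = 0 ∨ t = ℓ + 1 + n)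
        (fun t => (1 ≤ t ∧ t ≤ c₁) ∨ (s ≤ t ∧ t ≤ ℓ + n))
        (fun a b => 1 ≤ a ∧ a ≤ n ∧ b = a + ℓ)) (fun _ => True) f = 0 :=
  cohDim_eq_zero (fun _ hσ => hσ.2.2 1 (1 + ℓ) ⟨le_rfl, hn, rfl⟩
    fun t _ _ => hσ.2.1 t (by omega)) f

/-- The site after the prefix can always be filled. -/
theorem cohDim_windows_of_short_prefix (hs : s ≤ ℓ + 2) (hc : c₁ + 1 < n)
    (h : c₁ + 1 < s) (f : ℕ) :
    cohDim (ℓ + 2 + n) (intervalFamily (ℓ + 2 + n) (fun t => t = 0 ∨ t = ℓ + 1 + n)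
        (fun t => (1 ≤ t ∧ t ≤ c₁) ∨ (s ≤ t ∧ t ≤ ℓ + n))
        (fun a b => 1 ≤ a ∧ a ≤ n ∧ b = a + ℓ)) (fun _ => True) f = 0 := by
  refine cohDim_intervalFamily_eq_zero (v := c₁ + 1) (by omega) (by omega) (by omega) ?_ f
  rintro σ ⟨hZ, hO, hW⟩ ⟨a, b, hab, ha, hb, hf⟩
  refine hW n (n + ℓ) ⟨by omega, le_rfl, rfl⟩ fun t h1 h2 => ?_
  by_cases ht : s ≤ t
  · exact hO t (by omega)
  · exact hf t (by omega) (by omega) (by omega)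

/-- The site before the suffix can always be filled. -/
theorem cohDim_windows_of_short_suffix (hn : 1 ≤ n) (hs : ℓ + 2 < s) (hs' : s ≤ ℓ + 1 + n)
    (hc : n ≤ c₁ + 1) (h : c₁ + 1 < s) (f : ℕ) :
    cohDim (ℓ + 2 + n) (intervalFamily (ℓ + 2 + n) (fun t => t = 0 ∨ t = ℓ + 1 + n)
        (fun t => (1 ≤ t ∧ t ≤ c₁) ∨ (s ≤ t ∧ t ≤ ℓ + n))
        (fun a b => 1 ≤ a ∧ a ≤ n ∧ b = a + ℓ)) (fun _ => True) f = 0 := by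
  refine cohDim_intervalFamily_eq_zero (v := s - 1) (by omega) (by omega) (by omega) ?_ f
  rintro σ ⟨hZ, hO, hW⟩ ⟨a, b, hab, ha, hb, hf⟩
  refine hW 1 (1 + ℓ) ⟨le_rfl, hn, rfl⟩ fun t h1 h2 => ?_
  by_cases ht : t ≤ c₁
  · exact hO t (by omega)
  · exact hf t (by omega) (by omega) (by omega)

/-- Every window covers the gap between the prefix and the suffix. -/
theorem cohDim_windows_of_long (hn : 1 ≤ n) (hc₁ : c₁ ≤ ℓ) (hs : s ≤ ℓ + 2) (hns : n < s)
    (hc : n ≤ c₁ + 1) (h : c₁ + 1 < s) (f : ℕ) :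
    cohDim (ℓ + 2 + n) (intervalFamily (ℓ + 2 + n) (fun t => t = 0 ∨ t = ℓ + 1 + n)
        (fun t => (1 ≤ t ∧ t ≤ c₁) ∨ (s ≤ t ∧ t ≤ ℓ + n))
        (fun a b => 1 ≤ a ∧ a ≤ n ∧ b = a + ℓ)) (fun _ => True) f =
      if f = ℓ + 2 + n - 3 then 1 else 0 := by
  have hcard : ({0, ℓ + 1 + n, c₁ + 1} : Finset ℕ).card = 3 := by
    rw [Finset.card_eq_three]
    exact ⟨_, _, _, by omega, by omega, by omega, rfl⟩
  rw [← hcard]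
  refine cohDim_intervalFamily_eq_ite (v := c₁ + 1) (by omega) (by omega) (by omega)
    (by simp; omega) (fun σ => ⟨?_, ?_⟩) f
  · rintro ⟨⟨hZ, hO, hW⟩, a, b, hab, ha, hb, hf⟩
    refine eq_holesAt (fun t ht => hZ t ?_) fun t ht ht' => ?_
    · simp at ht; omega
    · simp at ht'
      by_cases hp : t ≤ c₁ ∨ s ≤ t
      · exact hO t (by omega)
      · exact hf t (by omega) (by omega) (by omega)
  · rintro rfl
    refine ⟨⟨fun t ht => ?_, fun t ht => ?_, fun a b hab hfull => ?_⟩, 1, 1 + ℓ,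
      ⟨le_rfl, hn, rfl⟩, by omega, by omega, fun t h1 h2 h3 => ?_⟩
    · rw [← Bool.not_eq_true, extc_holesAt]
      simp; omega
    · rw [extc_holesAt]
      simp; omega
    · have := hfull (c₁ + 1) (by omega) (by omega)
      rw [extc_holesAt] at this
      simp at this
    · rw [extc_holesAt]
      simp; omega

/-- When prefix and suffix are both short, fixing the hole after the prefix leaves the second
hole to the right of the first window. -/
theorem cohDim_windows_of_short (hnℓ : n ≤ ℓ) (hs : ℓ + 2 < s) (hs' : s ≤ ℓ + 1 + n)
    (hc : c₁ + 1 < n) (f : ℕ) :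
    cohDim (ℓ + 2 + n) (intervalFamily (ℓ + 2 + n) (fun t => t = 0 ∨ t = ℓ + 1 + n)
        (fun t => (1 ≤ t ∧ t ≤ c₁) ∨ (s ≤ t ∧ t ≤ ℓ + n))
        (fun a b => 1 ≤ a ∧ a ≤ n ∧ b = a + ℓ)) (fun _ => True) f =
      if s ≤ c₁ + ℓ + 3 ∧ f = ℓ + 2 + n - 4 then 1 else 0 := by
  rw [cohDim_intervalFamily (v := c₁ + 1) (by omega) (by omega) (by omega)
    (F := intervalFamily (ℓ + 2 + n) (fun t => (t = 0 ∨ t = ℓ + 1 + n) ∨ t = c₁ + 1)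
        (fun t => (1 ≤ t ∧ t ≤ c₁) ∨ (s ≤ t ∧ t ≤ ℓ + n) ∨ (c₁ + 2 ≤ t ∧ t ≤ ℓ + 1))
        (fun a b => 1 ≤ a ∧ a ≤ n ∧ b = a + ℓ))]
  · by_cases hmid : s ≤ c₁ + ℓ + 3
    · simp only [hmid, true_and]
      have hcard : ({0, ℓ + 1 + n, c₁ + 1, s - 1} : Finset ℕ).card = 4 := by
        rw [Finset.card_insert_of_notMem (by simp; omega), Finset.card_eq_three.2
          ⟨_, _, _, by omega, by omega, by omega, rfl⟩]
      rw [← hcard]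
      refine cohDim_intervalFamily_eq_ite (v := s - 1) (by omega) (by omega) (by omega)
        (by simp; omega) (fun σ => ⟨?_, ?_⟩) f
      · rintro ⟨⟨hZ, hO, hW⟩, a, b, hab, ha, hb, hf⟩
        have hca : c₁ + 1 < a := by
          by_contra hca
          have := hf (c₁ + 1) (by omega) (by omega) (by omega)
          simp [hZ] at this
        refine eq_holesAt (fun t ht => hZ t ?_) fun t ht ht' => ?_
        · simp at ht; omega
        · simp at ht'
          by_cases hp : t ≤ ℓ + 1 ∨ s ≤ t
          · exact hO t (by omega)
          · exact hf t (by omega) (by omega) (by omega)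
      · rintro rfl
        refine ⟨⟨fun t ht => ?_, fun t ht => ?_, fun a b hab hfull => ?_⟩, n, n + ℓ,
          ⟨by omega, le_rfl, rfl⟩, by omega, by omega, fun t h1 h2 h3 => ?_⟩
        · rw [← Bool.not_eq_true, extc_holesAt]
          simp; omega
        · rw [extc_holesAt]
          simp; omega
        · by_cases ha : a ≤ c₁ + 1
          · have := hfull (c₁ + 1) (by omega) (by omega)
            rw [extc_holesAt] at this
            simp at this
          · have := hfull (s - 1) (by omega) (by omega)
            rw [extc_holesAt] at this
            simp at this
        · rw [extc_holesAt]
          simp; omega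
    · simp only [hmid, false_and, if_false]
      refine cohDim_intervalFamily_eq_zero (v := s - 1) (by omega) (by omega) (by omega) ?_ f
      rintro σ ⟨hZ, hO, hW⟩ ⟨a, b, hab, ha, hb, hf⟩
      have hca : c₁ + 1 < a := by
        by_contra hca
        have := hf (c₁ + 1) (by omega) (by omega) (by omega)
        simp [hZ] at this
      refine hW (c₁ + 2) (c₁ + 2 + ℓ) ⟨by omega, by omega, rfl⟩ fun t h1 h2 => ?_
      by_cases ht : t ≤ ℓ + 1
      · exact hO t (by omega)
      · exact hf t (by omega) (by omega) (by omega)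
  · intro σ
    constructor
    · rintro ⟨hZ, hO, hW⟩
      exact ⟨⟨hZ, fun t ht => hO t (by omega), hW⟩, 1, 1 + ℓ, ⟨le_rfl, by omega, rfl⟩, by omega,
        by omega, fun t h1 h2 h3 => hO t (by omega)⟩
    · rintro ⟨⟨hZ, hO, hW⟩, a, b, hab, ha, hb, hf⟩
      refine ⟨hZ, fun t ht => ?_, hW⟩
      rcases ht with ht | ht | ht
      · exact hO t (Or.inl ht)
      · exact hO t (Or.inr ht)
      · exact hf t (by omega) (by omega) (by omega)

end Windows

/-- Cohomology of open chains of length `ℓ+3 ≤ N ≤ 2ℓ+2` with special boundary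
conditions `(c₁, cN)`, `0 ≤ c₁, cN ≤ ℓ`:
(i) if `c₁, cN ≥ N-ℓ-3` and `c₁ + cN < N-2`, the cohomology is one-dimensional and
concentrated at fermion number `N-3`;
(ii) if `ℓ+3 < N`, `c₁, cN < N-ℓ-3` and `c₁ + cN ≥ N-ℓ-4`, it is one-dimensional and
concentrated at fermion number `N-4`; otherwise it vanishes. -/
theorem cohomology_special_midsize_chain (ℓ N c₁ cN : ℕ) (hℓ : 1 ≤ ℓ)
    (hN1 : ℓ + 3 ≤ N) (hN2 : N ≤ 2 * ℓ + 2) (hc₁ : c₁ ≤ ℓ) (hcN : cN ≤ ℓ) :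
    ((N - (ℓ + 3) ≤ c₁ ∧ N - (ℓ + 3) ≤ cN ∧ c₁ + cN < N - 2) →
      ∀ f, cohDim N (OpenOK N ℓ c₁ cN) (fun _ => True) f =
        if f = N - 3 then 1 else 0) ∧
    ((ℓ + 3 < N ∧ c₁ < N - (ℓ + 3) ∧ cN < N - (ℓ + 3) ∧ N - (ℓ + 4) ≤ c₁ + cN) →
      ∀ f, cohDim N (OpenOK N ℓ c₁ cN) (fun _ => True) f =
        if f = N - 4 then 1 else 0) ∧
    (¬ (N - (ℓ + 3) ≤ c₁ ∧ N - (ℓ + 3) ≤ cN ∧ c₁ + cN < N - 2) →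
      ¬ (ℓ + 3 < N ∧ c₁ < N - (ℓ + 3) ∧ cN < N - (ℓ + 3) ∧ N - (ℓ + 4) ≤ c₁ + cN) →
      ∀ f, cohDim N (OpenOK N ℓ c₁ cN) (fun _ => True) f = 0) := by
  obtain ⟨n, rfl⟩ : ∃ n, N = ℓ + 2 + n := ⟨N - (ℓ + 2), by omega⟩
  obtain ⟨s, hs⟩ : ∃ s, s + cN = ℓ + 1 + n := ⟨ℓ + 1 + n - cN, by omega⟩
  have hn : 1 ≤ n := by omega
  simp only [cohDim_openOK hn hc₁ hcN hs]
  refine ⟨fun h f => ?_, fun h f => ?_, fun h h' f => ?_⟩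
  · exact cohDim_windows_of_long hn hc₁ (by omega) (by omega) (by omega) (by omega) f
  · rw [cohDim_windows_of_short (by omega) (by omega) (by omega) (by omega)]
    simp only [show s ≤ c₁ + ℓ + 3 by omega, true_and]
  · by_cases hov : s ≤ c₁ + 1
    · exact cohDim_windows_of_overlap hn hov f
    · by_cases hc : c₁ + 1 < n
      · by_cases hsℓ : s ≤ ℓ + 2
        · exact cohDim_windows_of_short_prefix hsℓ hc (by omega) f
        · rw [cohDim_windows_of_short (by omega) (by omega) (by omega) (by omega),
            if_neg (by omega)]
      · exact cohDim_windows_of_short_suffix hn (by omega) (by omega) (by omega) (by omega) f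

end
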